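/- Let U ∈ ℝ^{N×n}, F ∈ ℝ^{N×w}, C ∈ ℝ^{n×w}, and R = UC − F. Let S ∈ ℝ^{N×m} be a sampling points matrix and let Sbreve ∈ ℝ^{N×(N−m)} be its complementary sampling points matrix. Let rbar be the rank of SᵀR with nonzero singular values σ_1 ≥ … ≥ σ_rbar > 0, let r ≤ rbar, and suppose ΔU ∈ ℝ^{N×n} satisfies (i) SbreveᵀΔU = 0 and (ii) ‖Sᵀ((U + ΔU)C − F)‖_F² = ‖SᵀR‖_F² − Σ_{i=1}^{r} σ_i². Then ‖(U + ΔU)C − F‖_F² = Σ_{i=r+1}^{rbar} σ_i² + ‖Sbreveᵀ R‖_F². -/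

import Mathlib

open Matrix Finset

/-- Squared Frobenius norm of a real matrix. -/
noncomputable def frobSq {m k : ℕ} (A : Matrix (Fin m) (Fin k) ℝ) : ℝ :=
  ∑ i, ∑ j, A i j ^ 2

/-- The matrix `[e_{s 0}, …, e_{s (m-1)}] ∈ ℝ^{N×m}` whose columns are the canonical
unit vectors of `ℝ^N` selected by `s`. -/
noncomputable def samplingMatrix {N m : ℕ} (s : Fin m → Fin N) : Matrix (Fin N) (Fin m) ℝ :=
  Matrix.of fun i k => if i = s k then 1 else 0

/-- `σ : Fin r → ℝ` is the (decreasingly sorted) list of nonzero singular values of `M`. -/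
def IsSingularValues {m k : ℕ} (M : Matrix (Fin m) (Fin k) ℝ) (r : ℕ) (σ : Fin r → ℝ) : Prop :=
  (∀ i, 0 < σ i) ∧ Antitone σ ∧
  ∃ (u : Fin r → Fin m → ℝ) (v : Fin r → Fin k → ℝ),
    (∀ i j, u i ⬝ᵥ u j = if i = j then (1 : ℝ) else 0) ∧
    (∀ i j, v i ⬝ᵥ v j = if i = j then (1 : ℝ) else 0) ∧
    M = ∑ i, σ i • Matrix.vecMulVec (u i) (v i)

lemma samplingMatrix_transpose_mul_apply {N m w : ℕ} (s : Fin m → Fin N)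
    (A : Matrix (Fin N) (Fin w) ℝ) (i : Fin m) (j : Fin w) :
    ((samplingMatrix s)ᵀ * A) i j = A (s i) j := by
  simp [samplingMatrix, Matrix.mul_apply]

/-- The squared Frobenius norm splits over sampled and non-sampled rows. -/
lemma frobSq_eq_add_of_range_eq_compl {N m k w : ℕ} {s : Fin m → Fin N} {sb : Fin k → Fin N}
    (hs : Function.Injective s) (hsb : Function.Injective sb)
    (hcompl : Set.range sb = (Set.range s)ᶜ) (A : Matrix (Fin N) (Fin w) ℝ) :
    frobSq A = frobSq ((samplingMatrix s)ᵀ * A) + frobSq ((samplingMatrix sb)ᵀ * A) := by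
  have hbij : Function.Bijective (Sum.elim s sb) := by
    refine ⟨hs.sumElim hsb fun a b h => ?_, ?_⟩
    · have hb : sb b ∈ (Set.range s)ᶜ := hcompl ▸ Set.mem_range_self b
      exact hb ⟨a, h⟩
    · rw [← Set.range_eq_univ, Set.Sum.elim_range, hcompl, Set.union_compl_self]
  simp only [frobSq, samplingMatrix_transpose_mul_apply]
  rw [← hbij.sum_comp, Fintype.sum_sum_type]
  rfl

lemma frobSq_eq_trace {m k : ℕ} (A : Matrix (Fin m) (Fin k) ℝ) :
    frobSq A = (A * Aᵀ).trace := by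
  simp [frobSq, Matrix.trace, Matrix.mul_apply, sq]

lemma IsSingularValues.frobSq_eq {m k r : ℕ} {M : Matrix (Fin m) (Fin k) ℝ} {σ : Fin r → ℝ}
    (h : IsSingularValues M r σ) : frobSq M = ∑ i, σ i ^ 2 := by
  obtain ⟨-, -, u, v, hu, hv, hM⟩ := h
  have hu' : Matrix.of u * (Matrix.of u)ᵀ = 1 := by
    ext i j
    simpa [Matrix.mul_apply, Matrix.one_apply, dotProduct] using hu i j
  have hv' : Matrix.of v * (Matrix.of v)ᵀ = 1 := by
    ext i j
    simpa [Matrix.mul_apply, Matrix.one_apply, dotProduct] using hv i j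
  have hM' : M = (Matrix.of u)ᵀ * (Matrix.diagonal σ * Matrix.of v) := by
    rw [hM]
    ext i j
    simp only [Matrix.sum_apply, Matrix.smul_apply, Matrix.vecMulVec_apply, smul_eq_mul,
      Matrix.mul_apply (M := (Matrix.of u)ᵀ), Matrix.diagonal_mul, Matrix.transpose_apply,
      Matrix.of_apply]
    exact Finset.sum_congr rfl fun _ _ => by ring
  calc frobSq M
      = ((Matrix.of u)ᵀ * (Matrix.diagonal σ * (Matrix.of v * (Matrix.of v)ᵀ) *
          Matrix.diagonal σ * Matrix.of u)).trace := by
        rw [frobSq_eq_trace, hM']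
        simp only [Matrix.transpose_mul, Matrix.transpose_transpose, Matrix.diagonal_transpose,
          Matrix.mul_assoc]
    _ = (Matrix.diagonal σ * Matrix.diagonal σ).trace := by
        rw [hv', Matrix.mul_one, Matrix.trace_mul_comm, Matrix.mul_assoc, hu', Matrix.mul_one]
    _ = ∑ i, σ i ^ 2 := by simp [Matrix.trace_diagonal, sq]

/-- If the update `ΔU` vanishes on the non-sampled rows (`SbreveᵀΔU = 0`) and achieves
the optimal sampled residual `‖Sᵀ((U+ΔU)C − F)‖_F² = ‖SᵀR‖_F² − ∑_{i=1}^r σ_i²`,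
then the full residual satisfies
`‖(U+ΔU)C − F‖_F² = ∑_{i=r+1}^{rbar} σ_i² + ‖Sbreveᵀ R‖_F²`. -/
theorem adapted_full_residual_identity
    {N n w m : ℕ}
    (U : Matrix (Fin N) (Fin n) ℝ) (F : Matrix (Fin N) (Fin w) ℝ)
    (C : Matrix (Fin n) (Fin w) ℝ)
    (R : Matrix (Fin N) (Fin w) ℝ) (hR : R = U * C - F)
    (s : Fin m → Fin N) (hs : Function.Injective s)
    (sb : Fin (N - m) → Fin N) (hsb : Function.Injective sb)
    (hcompl : Set.range sb = (Set.range s)ᶜ)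
    (rbar : ℕ) (σ : Fin rbar → ℝ)
    (hσ : IsSingularValues ((samplingMatrix s)ᵀ * R) rbar σ)
    (r : ℕ) (hr : r ≤ rbar)
    (ΔU : Matrix (Fin N) (Fin n) ℝ)
    (h1 : (samplingMatrix sb)ᵀ * ΔU = 0)
    (h2 : frobSq ((samplingMatrix s)ᵀ * ((U + ΔU) * C - F)) =
      frobSq ((samplingMatrix s)ᵀ * R) -
        ∑ i : Fin rbar, if (i : ℕ) < r then σ i ^ 2 else 0) :
    frobSq ((U + ΔU) * C - F) =
      (∑ i : Fin rbar, if r ≤ (i : ℕ) then σ i ^ 2 else 0) +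
        frobSq ((samplingMatrix sb)ᵀ * R) := by
  have hsb_res : (samplingMatrix sb)ᵀ * ((U + ΔU) * C - F) = (samplingMatrix sb)ᵀ * R := by
    rw [hR, Matrix.add_mul, add_sub_right_comm, Matrix.mul_add, ← Matrix.mul_assoc _ ΔU, h1,
      Matrix.zero_mul, add_zero]
  rw [frobSq_eq_add_of_range_eq_compl hs hsb hcompl, hsb_res, h2, hσ.frobSq_eq,
    ← Finset.sum_sub_distrib]
  congr 1
  refine Finset.sum_congr rfl fun i _ => ?_
  by_cases hi : (i : ℕ) < r
  · simp [hi, hi.not_ge]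
  · simp [hi, not_lt.mp hi]
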